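/- arXiv:0911.1737 — 3 statements merged into one kernel-verified Lean document; each statement's English description precedes it below -/
import Mathlib

section
/- For all positive integers n and nonnegative integers k, the n×n determinant over ℚ with (i,j)-entry (2k+1)/(i+j+k+2)·C(2i+2j+2, i+j+k+1), for 0 ≤ i, j ≤ n−1, equals (−1)^{kn₁+C(k+1,2)} if n = n₁(2k+1)−k−1 for a positive integer n₁; equals (−1)^{kn₁} if n = n₁(2k+1) for a positive integer n₁; and equals 0 if n is congruent to neither 0 nor k modulo 2k+1. -/
open Finset

/-- The binomial coefficient `C(m, x)` with an integer lower index, zero when `x < 0`. -/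
def intChoose (m : ℕ) (x : ℤ) : ℚ := if 0 ≤ x then (m.choose x.toNat : ℚ) else 0

theorem intChoose_natCast (m p : ℕ) : intChoose m p = m.choose p := by
  simp [intChoose]

theorem intChoose_of_neg (m : ℕ) {x : ℤ} (hx : x < 0) : intChoose m x = 0 := by
  simp [intChoose, hx]

theorem intChoose_zero (m : ℕ) : intChoose m 0 = 1 := by
  simp [intChoose]

theorem intChoose_succ (m : ℕ) (x : ℤ) :
    intChoose (m + 1) x = intChoose m x + intChoose m (x - 1) := by
  rcases lt_trichotomy x 0 with hx | rfl | hx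
  · simp [intChoose_of_neg _ hx, intChoose_of_neg m (show x - 1 < 0 by omega)]
  · simp [intChoose_zero, intChoose_of_neg m (show (-1 : ℤ) < 0 by omega)]
  · obtain ⟨p, rfl⟩ : ∃ p : ℕ, x = ((p + 1 : ℕ) : ℤ) := ⟨(x - 1).toNat, by omega⟩
    have h : ((p + 1 : ℕ) : ℤ) - 1 = (p : ℕ) := by push_cast; ring
    rw [h, intChoose_natCast, intChoose_natCast, intChoose_natCast, Nat.choose_succ_succ]
    push_cast
    ring

theorem intChoose_symm (m : ℕ) {x y : ℤ} (h : x + y = m) : intChoose m x = intChoose m y := by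
  have large : ∀ z : ℤ, m < z → intChoose m z = 0 := fun z hz => by
    lift z to ℕ using by omega
    rw [intChoose_natCast, Nat.choose_eq_zero_of_lt (by omega), Nat.cast_zero]
  rcases lt_or_ge x 0 with hx | hx
  · rw [intChoose_of_neg _ hx, large y (by omega)]
  rcases lt_or_ge y 0 with hy | hy
  · rw [intChoose_of_neg _ hy, large x (by omega)]
  lift x to ℕ using hx
  lift y to ℕ using hy
  rw [intChoose_natCast, intChoose_natCast, Nat.choose_symm_of_eq_add (by omega : m = x + y)]

theorem sum_choose_mul_intChoose (m l : ℕ) (x : ℤ) :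
    ∑ p ∈ range (m + 1), (m.choose p : ℚ) * intChoose l (x - p) = intChoose (m + l) x := by
  induction m generalizing x with
  | zero => simp
  | succ m ih =>
    rw [show m + 1 + l = m + l + 1 by ring, intChoose_succ, ← ih, ← ih,
      sum_choose_succ_mul (fun p _ => intChoose l (x - p)) m]
    congr 1
    refine sum_congr rfl fun p _ => ?_
    congr 2
    push_cast
    ring

theorem sum_choose_mul_intChoose_add (i l : ℕ) (x : ℤ) :
    ∑ s ∈ range (i + 1), intChoose (2 * i + 1) (i - s) *
      (intChoose l (x - i + s) + intChoose l (x - i - 1 - s)) =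
      intChoose (2 * i + 1 + l) x := by
  rw [← sum_choose_mul_intChoose, show 2 * i + 1 + 1 = (i + 1) + (i + 1) by ring,
    sum_range_add (fun p : ℕ => ((2 * i + 1).choose p : ℚ) * intChoose l (x - p)),
    ← sum_range_reflect (fun p : ℕ => ((2 * i + 1).choose p : ℚ) * intChoose l (x - p)),
    ← sum_add_distrib]
  refine sum_congr rfl fun s hs => ?_
  have hs : s ≤ i := by simpa [Nat.lt_succ_iff] using hs
  obtain ⟨d, rfl⟩ := Nat.exists_eq_add_of_le hs
  have h1 : ((s + d : ℕ) : ℤ) - s = (d : ℕ) := by push_cast; ring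
  have h2 : s + d + 1 - 1 - s = d := by omega
  rw [h1, h2, intChoose_natCast,
    Nat.choose_symm_of_eq_add (show 2 * (s + d) + 1 = (s + d + 1 + s) + d by ring), mul_add]
  congr 3 <;> push_cast <;> ring

/-- The coefficients of `(z + z⁻¹) ^ (2 * j + 1)` in the Chebyshev basis of odd index,
extended antisymmetrically to integer indices. -/
def ballotCoeff (j : ℕ) (t : ℤ) : ℚ :=
  intChoose (2 * j + 1) (j - t) - intChoose (2 * j + 1) (j - t - 1)

theorem ballotCoeff_antisymm (j : ℕ) {t u : ℤ} (h : t + u = -2) :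
    ballotCoeff j t = -ballotCoeff j u := by
  obtain rfl : u = -2 - t := by omega
  rw [ballotCoeff, ballotCoeff,
    intChoose_symm (2 * j + 1) (show (j - t : ℤ) + (j - (-2 - t) - 1) = _ by push_cast; ring),
    intChoose_symm (2 * j + 1) (show (j - t - 1 : ℤ) + (j - (-2 - t)) = _ by push_cast; ring)]
  ring

theorem ballotCoeff_of_lt {j : ℕ} {t : ℤ} (h : j < t) : ballotCoeff j t = 0 := by
  rw [ballotCoeff, intChoose_of_neg _ (by omega), intChoose_of_neg _ (by omega), sub_zero]

theorem ballotCoeff_self (j : ℕ) : ballotCoeff j j = 1 := by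
  rw [ballotCoeff, sub_self, intChoose_zero, intChoose_of_neg _ (by omega), sub_zero]

theorem sum_intChoose_mul_ballotCoeff (i j k : ℕ) :
    ∑ s ∈ range (i + 1), intChoose (2 * i + 1) (i - s) *
      (ballotCoeff j (s + k) - ballotCoeff j (s - k - 1)) =
      intChoose (2 * i + 2 * j + 2) (i + j + k + 1) -
        intChoose (2 * i + 2 * j + 2) (i + j + k + 2) := by
  rw [show 2 * i + 2 * j + 2 = 2 * i + 1 + (2 * j + 1) by ring,
    ← sum_choose_mul_intChoose_add, ← sum_choose_mul_intChoose_add, ← sum_sub_distrib]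
  refine sum_congr rfl fun s _ => ?_
  rw [← mul_sub, ballotCoeff, ballotCoeff]
  rw [intChoose_symm (2 * j + 1)
      (show (j - (s + k) : ℤ) + (i + j + k + 1 - i + s) = _ by push_cast; ring),
    intChoose_symm (2 * j + 1)
      (show (j - (s + k) - 1 : ℤ) + (i + j + k + 2 - i + s) = _ by push_cast; ring),
    show (j - (s - k - 1) : ℤ) = i + j + k + 2 - i - 1 - s by ring,
    show (i + j + k + 2 - i - 1 - s - 1 : ℤ) = i + j + k + 1 - i - 1 - s by ring]
  ring

theorem ballot_eq_intChoose_sub (m k : ℕ) :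
    ((2 * k + 1 : ℚ) / ((m + k + 2 : ℕ) : ℚ)) * ((2 * m + 2).choose (m + k + 1) : ℚ) =
      intChoose (2 * m + 2) (m + k + 1) - intChoose (2 * m + 2) (m + k + 2) := by
  have h1 : (m + k + 1 : ℤ) = (m + k + 1 : ℕ) := by push_cast; ring
  have h2 : (m + k + 2 : ℤ) = (m + k + 1 + 1 : ℕ) := by push_cast; ring
  rw [h1, h2, intChoose_natCast, intChoose_natCast]
  rcases le_or_gt k (m + 1) with h | h
  · have := Nat.choose_succ_right_eq (2 * m + 2) (m + k + 1)
    obtain ⟨d, hd⟩ := Nat.exists_eq_add_of_le h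
    rw [show 2 * m + 2 - (m + k + 1) = d by omega] at this
    have hq : ((2 * m + 2).choose (m + k + 1 + 1) : ℚ) * (m + k + 2) =
        (2 * m + 2).choose (m + k + 1) * d := by
      have := congrArg (Nat.cast (R := ℚ)) this
      push_cast at this
      linear_combination this
    have hd' : (m : ℚ) + 1 = k + d := by exact_mod_cast hd
    have h0 : (m + k + 2 : ℚ) ≠ 0 := by positivity
    push_cast
    field_simp
    linear_combination hq - ((2 * m + 2).choose (m + k + 1) : ℚ) * hd'
  · rw [Nat.choose_eq_zero_of_lt (by omega), Nat.choose_eq_zero_of_lt (by omega)]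
    simp

/-- The sparse matrix to which the ballot Hankel matrix reduces. -/
def ballotCore (k n : ℕ) : Matrix (Fin n) (Fin n) ℚ := Matrix.of fun s t =>
  (if (t : ℤ) = s + k then 1 else 0) - (if (t : ℤ) = s - k - 1 then 1 else 0) +
    (if (t : ℤ) = k - 1 - s then 1 else 0)

theorem sum_ite_mul_ballotCoeff {j n : ℕ} (hj : j < n) (x : ℤ) :
    ∑ t : Fin n, (if (t : ℤ) = x then 1 else 0) * ballotCoeff j t =
      if 0 ≤ x then ballotCoeff j x else 0 := by
  by_cases hx : 0 ≤ x
  · lift x to ℕ using hx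
    by_cases hn : x < n
    · rw [sum_eq_single (⟨x, hn⟩ : Fin n)]
      · simp
      · intro t _ ht
        have : (t : ℕ) ≠ x := fun h => ht (Fin.ext h)
        simp [this]
      · simp
    · rw [ballotCoeff_of_lt (by omega), ite_self]
      refine sum_eq_zero fun t _ => ?_
      rw [if_neg (by omega), zero_mul]
  · rw [if_neg hx]
    refine sum_eq_zero fun t _ => ?_
    rw [if_neg (by omega), zero_mul]

theorem sum_ballotCore_mul_ballotCoeff (k : ℕ) {j n : ℕ} (hj : j < n) (s : Fin n) :
    ∑ t, ballotCore k n s t * ballotCoeff j t =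
      ballotCoeff j (s + k) - ballotCoeff j (s - k - 1) := by
  simp only [ballotCore, Matrix.of_apply, add_mul, sub_mul, sum_add_distrib, sum_sub_distrib,
    sum_ite_mul_ballotCoeff hj]
  rw [if_pos (by positivity)]
  rcases lt_trichotomy (s : ℕ) k with h | h | h
  · rw [if_neg (by omega), if_pos (by omega),
      ballotCoeff_antisymm j (show (s - k - 1 : ℤ) + (k - 1 - s) = -2 by ring)]
    ring
  · have h0 := ballotCoeff_antisymm j (show (-1 : ℤ) + (-1) = -2 by norm_num)
    rw [if_neg (by omega), if_neg (by omega), show (s - k - 1 : ℤ) = -1 by omega]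
    linarith
  · rw [if_pos (by omega), if_neg (by omega), add_zero]

theorem det_ballot_eq_det_ballotCore (n k : ℕ) :
    Matrix.det (Matrix.of fun i j : Fin n =>
      ((2 * k + 1 : ℚ) / ((i.1 + j.1 + k + 2 : ℕ) : ℚ)) *
        ((2 * i.1 + 2 * j.1 + 2).choose (i.1 + j.1 + k + 1) : ℚ)) = (ballotCore k n).det := by
  let B : Matrix (Fin n) (Fin n) ℚ := Matrix.of fun i s => intChoose (2 * i + 1) (i - s)
  let L : Matrix (Fin n) (Fin n) ℚ := Matrix.of fun j t => ballotCoeff j t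
  have hB : B.det = 1 := by
    rw [Matrix.det_of_isLowerTriangular B fun i s (h : i < s) =>
      intChoose_of_neg _ (by have : i.1 < s.1 := h; omega)]
    exact prod_eq_one fun i _ => by simp [B, intChoose_zero]
  have hL : L.det = 1 := by
    rw [Matrix.det_of_isLowerTriangular L fun i s (h : i < s) =>
      ballotCoeff_of_lt (by have : i.1 < s.1 := h; omega)]
    exact prod_eq_one fun i _ => by simp [L, ballotCoeff_self]
  have key : Matrix.of (fun i j : Fin n =>
      ((2 * k + 1 : ℚ) / ((i.1 + j.1 + k + 2 : ℕ) : ℚ)) *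
        ((2 * i.1 + 2 * j.1 + 2).choose (i.1 + j.1 + k + 1) : ℚ)) =
      B * (ballotCore k n * L.transpose) := by
    ext i j
    have h := ballot_eq_intChoose_sub (i + j) k
    rw [mul_add] at h
    push_cast at h
    rw [Matrix.of_apply, Matrix.mul_apply]
    simp only [Matrix.mul_apply, Matrix.transpose_apply, B, L, Matrix.of_apply,
      sum_ballotCore_mul_ballotCoeff k j.2]
    rw [Fin.sum_univ_eq_sum_range (fun s => intChoose (2 * i + 1) (i - s) *
      (ballotCoeff j (s + k) - ballotCoeff j (s - k - 1))) n,
      ← sum_subset (range_subset_range.2 i.2), sum_intChoose_mul_ballotCoeff]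
    · push_cast
      exact h
    · intro s _ hs
      rw [mem_range, not_lt] at hs
      rw [intChoose_of_neg _ (by omega), zero_mul]
  rw [key, Matrix.det_mul, Matrix.det_mul, Matrix.det_transpose, hB, hL, one_mul, mul_one]

theorem finRotate_pow_apply_val (n s : ℕ) (i : Fin (n + 1)) :
    ((finRotate (n + 1) ^ s) i : ℕ) = (i + s) % (n + 1) := by
  induction s with
  | zero => simp [Nat.mod_eq_of_lt i.2]
  | succ s ih =>
    rw [pow_succ', Equiv.Perm.mul_apply, finRotate_apply, Fin.val_add, ih, Fin.val_one']
    simp [add_assoc]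

theorem sign_finRotate_pow_of_odd (k s : ℕ) :
    Equiv.Perm.sign (finRotate (2 * k + 1) ^ s) = 1 := by
  rw [map_pow, sign_finRotate, Nat.add_sub_cancel, pow_mul]
  simp

theorem det_ballotCore_add (k n : ℕ) :
    (ballotCore k (n + (2 * k + 1))).det = (-1) ^ k * (ballotCore k n).det := by
  let e : Fin n ⊕ Fin (2 * k + 1) ≃ Fin (n + (2 * k + 1)) := finSumFinEquiv
  let ρ : Equiv.Perm (Fin n ⊕ Fin (2 * k + 1)) :=
    Equiv.Perm.sumCongr 1 (finRotate (2 * k + 1) ^ k)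
  let c : Fin (k + 1) ⊕ Fin k ≃ Fin (2 * k + 1) :=
    finSumFinEquiv.trans (finCongr (by ring))
  let f : (Fin n ⊕ Fin (k + 1)) ⊕ Fin k ≃ Fin n ⊕ Fin (2 * k + 1) :=
    (Equiv.sumAssoc _ _ _).trans (Equiv.sumCongr (Equiv.refl _) c)
  have hρ : Equiv.Perm.sign ρ = 1 := by
    rw [Equiv.Perm.sign_sumCongr, sign_finRotate_pow_of_odd, map_one, one_mul]
  let M := (((ballotCore k (n + (2 * k + 1))).submatrix e e).submatrix id ρ).submatrix f f
  have hM : M.det = (ballotCore k (n + (2 * k + 1))).det := by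
    rw [Matrix.det_submatrix_equiv_self, Matrix.det_permute', hρ,
      Matrix.det_submatrix_equiv_self]
    simp
  have hA (s : Fin n) : (e (f (.inl (.inl s))) : ℕ) = s := by simp [e, f]
  have hB (s : Fin (k + 1)) : (e (f (.inl (.inr s))) : ℕ) = n + s := by simp [e, f, c]
  have hC (s : Fin k) : (e (f (.inr s)) : ℕ) = n + (k + 1) + s := by simp [e, f, c]; ring
  have hA' (s : Fin n) : (e (ρ (f (.inl (.inl s)))) : ℕ) = s := by simp [e, f, ρ]
  have hB' (s : Fin (k + 1)) : (e (ρ (f (.inl (.inr s)))) : ℕ) = n + k + s := by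
    simp [e, f, c, ρ, finRotate_pow_apply_val]
    rw [Nat.mod_eq_of_lt (by omega)]; ring
  have hC' (s : Fin k) : (e (ρ (f (.inr s))) : ℕ) = n + s := by
    simp [e, f, c, ρ, finRotate_pow_apply_val]
    rw [show k + 1 + (s : ℕ) + k = s + (2 * k + 1) by ring, Nat.add_mod_right,
      Nat.mod_eq_of_lt (by omega)]
  have entry (a b) : M a b =
      (if ((e (ρ (f b)) : ℕ) : ℤ) = (e (f a) : ℕ) + k then 1 else 0) -
        (if ((e (ρ (f b)) : ℕ) : ℤ) = (e (f a) : ℕ) - k - 1 then 1 else 0) +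
        (if ((e (ρ (f b)) : ℕ) : ℤ) = k - 1 - (e (f a) : ℕ) then 1 else 0) := rfl
  have h₂₁ : M.toBlocks₂₁ = 0 := by
    ext a (b | b)
    · have := b.2
      simp only [Matrix.toBlocks₂₁, Matrix.of_apply, entry, hC, hA', Matrix.zero_apply]
      rw [if_neg (by omega), if_neg (by omega), if_neg (by omega)]; ring
    · simp only [Matrix.toBlocks₂₁, Matrix.of_apply, entry, hC, hB', Matrix.zero_apply]
      rw [if_neg (by omega), if_neg (by omega), if_neg (by omega)]; ring
  have h₂₂ : M.toBlocks₂₂ = -1 := by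
    ext a b
    simp only [Matrix.toBlocks₂₂, Matrix.of_apply, entry, hC, hC', Matrix.neg_apply,
      Matrix.one_apply, Fin.ext_iff]
    rw [if_neg (by omega), if_neg (by omega : ¬ (((n + b : ℕ) : ℤ) = k - 1 - _))]
    by_cases h : (a : ℕ) = b
    · rw [if_pos (by omega), if_pos h]; ring
    · rw [if_neg (by omega), if_neg h]; ring
  have h₁₁ : M.toBlocks₁₁ =
      Matrix.fromBlocks (ballotCore k n) 0 M.toBlocks₁₁.toBlocks₂₁ 1 := by
    rw [← Matrix.fromBlocks_toBlocks M.toBlocks₁₁, Matrix.fromBlocks_inj]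
    refine ⟨?_, ?_, by simp, ?_⟩
    · ext a b
      simp only [Matrix.toBlocks₁₁, Matrix.of_apply, entry, hA, hA', ballotCore]
    · ext a b
      have := a.2
      simp only [Matrix.toBlocks₁₁, Matrix.toBlocks₁₂, Matrix.of_apply, entry, hA, hB',
        Matrix.zero_apply]
      rw [if_neg (by omega), if_neg (by omega), if_neg (by omega)]; ring
    · ext a b
      simp only [Matrix.toBlocks₁₁, Matrix.toBlocks₂₂, Matrix.of_apply, entry, hB, hB',
        Matrix.one_apply, Fin.ext_iff]
      rw [if_neg (by omega : ¬ (((n + k + b : ℕ) : ℤ) = _ - k - 1)),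
        if_neg (by omega : ¬ (((n + k + b : ℕ) : ℤ) = k - 1 - _))]
      by_cases h : (a : ℕ) = b
      · rw [if_pos (by omega), if_pos h]; ring
      · rw [if_neg (by omega), if_neg h]; ring
  rw [← hM, ← Matrix.fromBlocks_toBlocks M, h₂₁, Matrix.det_fromBlocks_zero₂₁, h₁₁,
    Matrix.det_fromBlocks_zero₁₂, h₂₂, Matrix.det_neg, Matrix.det_one, Matrix.det_one,
    Fintype.card_fin]
  ring

theorem det_ballotCore_add_mul (k n m : ℕ) :
    (ballotCore k (n + m * (2 * k + 1))).det = (-1) ^ (k * m) * (ballotCore k n).det := by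
  induction m with
  | zero => rw [zero_mul, add_zero, mul_zero, pow_zero, one_mul]
  | succ m ih =>
    rw [show n + (m + 1) * (2 * k + 1) = n + m * (2 * k + 1) + (2 * k + 1) by ring,
      det_ballotCore_add, ih]
    ring

theorem det_antidiagonal (k : ℕ) :
    (Matrix.of fun i j : Fin k => if (i : ℕ) + j + 1 = k then (1 : ℚ) else 0).det =
      (-1) ^ k.choose 2 := by
  induction k with
  | zero => simp
  | succ k ih =>
    rw [Matrix.det_succ_row_zero, sum_eq_single (Fin.last k)]
    · have : (Matrix.of fun i j : Fin (k + 1) =>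
          if (i : ℕ) + j + 1 = k + 1 then (1 : ℚ) else 0).submatrix Fin.succ
            (Fin.last k).succAbove =
          Matrix.of fun i j : Fin k => if (i : ℕ) + j + 1 = k then (1 : ℚ) else 0 := by
        ext i j
        simp only [Matrix.submatrix_apply, Matrix.of_apply, Fin.succAbove_last, Fin.val_succ,
          Fin.val_castSucc]
        congr 1
        rw [eq_iff_iff]
        omega
      rw [this, ih, Nat.choose_succ_succ' k 1]
      simp [pow_add]
    · intro j _ hj
      have : (j : ℕ) ≠ k := fun h => hj (Fin.ext h)
      simp [this]
    · simp

theorem det_ballotCore_self (k : ℕ) : (ballotCore k k).det = (-1) ^ k.choose 2 := by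
  rw [← det_antidiagonal]
  congr 1
  ext i j
  simp only [ballotCore, Matrix.of_apply]
  rw [if_neg (by omega), if_neg (by omega)]
  by_cases h : (i : ℕ) + j + 1 = k
  · rw [if_pos (by omega), if_pos h]; ring
  · rw [if_neg (by omega), if_neg h]; ring

theorem det_ballotCore_eq_zero {k r : ℕ} (h0 : r ≠ 0) (hk : r ≠ k) (hr : r < 2 * k + 1) :
    (ballotCore k r).det = 0 := by
  have key (s : Fin r) (hs : (s : ℕ) = 0 ∧ r < k ∨ (s : ℕ) = k) : (ballotCore k r).det = 0 :=
    Matrix.det_eq_zero_of_row_eq_zero s fun t => by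
      simp only [ballotCore, Matrix.of_apply]
      rw [if_neg (by omega), if_neg (by omega), if_neg (by omega)]; ring
  rcases lt_or_gt_of_ne hk with h | h
  · exact key ⟨0, by omega⟩ (.inl ⟨rfl, h⟩)
  · exact key ⟨k, h⟩ (.inr rfl)

/-- Corollary 13: the determinant of the `n×n` matrix of ballot numbers
`(2k+1)/(i+j+k+2)·C(2i+2j+2, i+j+k+1)`, computed in `ℚ`.
The hypothesis `n = n₁(2k+1)−k−1` is stated additively as `n + k + 1 = n₁(2k+1)`. -/
theorem det_ballot_hankel_one (n : ℕ) (hn : 0 < n) (k : ℕ) :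
    (∀ n₁ : ℕ, 0 < n₁ → n + k + 1 = n₁ * (2 * k + 1) →
      Matrix.det (Matrix.of fun i j : Fin n =>
          ((2 * k + 1 : ℚ) / ((i.1 + j.1 + k + 2 : ℕ) : ℚ)) *
            ((2 * i.1 + 2 * j.1 + 2).choose (i.1 + j.1 + k + 1) : ℚ)) =
        (-1 : ℚ) ^ (k * n₁ + Nat.choose (k + 1) 2)) ∧
    (∀ n₁ : ℕ, 0 < n₁ → n = n₁ * (2 * k + 1) →
      Matrix.det (Matrix.of fun i j : Fin n =>
          ((2 * k + 1 : ℚ) / ((i.1 + j.1 + k + 2 : ℕ) : ℚ)) *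
            ((2 * i.1 + 2 * j.1 + 2).choose (i.1 + j.1 + k + 1) : ℚ)) =
        (-1 : ℚ) ^ (k * n₁)) ∧
    (n % (2 * k + 1) ≠ 0 ∧ n % (2 * k + 1) ≠ k % (2 * k + 1) →
      Matrix.det (Matrix.of fun i j : Fin n =>
          ((2 * k + 1 : ℚ) / ((i.1 + j.1 + k + 2 : ℕ) : ℚ)) *
            ((2 * i.1 + 2 * j.1 + 2).choose (i.1 + j.1 + k + 1) : ℚ)) = 0) := by
  rw [det_ballot_eq_det_ballotCore]
  refine ⟨fun n₁ hn₁ h => ?_, fun n₁ _ h => ?_, fun ⟨h0, hk⟩ => ?_⟩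
  · obtain ⟨m, rfl⟩ := Nat.exists_eq_add_of_le' hn₁
    obtain rfl : n = k + m * (2 * k + 1) := by rw [add_mul] at h; omega
    rw [det_ballotCore_add_mul, det_ballotCore_self, Nat.choose_succ_succ' k 1,
      Nat.choose_one_right, ← pow_add,
      show k * (m + 1) + (k + k.choose 2) = k * m + k.choose 2 + 2 * k by ring, pow_add _ _ (2 * k),
      pow_mul (-1 : ℚ) 2 k]
    simp
  · have := det_ballotCore_add_mul k 0 n₁
    rw [zero_add, ← h] at this
    rw [this, Matrix.det_isEmpty, mul_one]
  · rw [Nat.mod_eq_of_lt (by omega : k < 2 * k + 1)] at hk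
    have := det_ballotCore_add_mul k (n % (2 * k + 1)) (n / (2 * k + 1))
    rw [mul_comm (n / _), Nat.mod_add_div] at this
    rw [this, det_ballotCore_eq_zero h0 hk (Nat.mod_lt _ (by omega)), mul_zero]
end

section
/- For all positive integers n and nonnegative integers k, the n×n determinant det_{0≤i,j≤n−1}( Σ_{ℓ≥0} ( T(i+j; ℓ, ℓ+k) − T(i+j; ℓ, ℓ+k+2) ) ) equals (−1)^{n₁·C(k+1,2)} if n = n₁(k+1) for a positive integer n₁, and equals 0 if k+1 does not divide n. -/
/-- The trinomial coefficient `T(n; k₁, k₂) = n!/(k₁!·k₂!·(n−k₁−k₂)!)`, equal to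
`C(n,k₁)·C(n−k₁,k₂)`, with the convention that it is `0` when `k₁ + k₂ > n`
(automatic here, since then one of the two binomial coefficients vanishes). -/
def trinom (n k₁ k₂ : ℕ) : ℕ :=
  n.choose k₁ * (n - k₁).choose k₂

open Polynomial in
theorem det_bilin_of_isMonicOfDegree {R : Type*} [CommRing R] {n : ℕ} (L : R[X] →ₗ[R] R)
    (p q : Fin n → R[X]) (hp : ∀ i, IsMonicOfDegree (p i) i) (hq : ∀ i, IsMonicOfDegree (q i) i) :
    Matrix.det (Matrix.of fun i j => L (p i * q j)) =
      Matrix.det (Matrix.of fun i j : Fin n => L (X ^ (i : ℕ) * X ^ (j : ℕ))) := by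
  have expand (r : R[X]) (i : Fin n) (hr : IsMonicOfDegree r i) :
      r = ∑ s : Fin n, r.coeff s • X ^ (s : ℕ) := by
    conv_lhs => rw [r.as_sum_range' n (by rw [hr.natDegree_eq]; exact i.2)]
    rw [Finset.sum_range]
    simp [← smul_X_eq_monomial]
  have key : (Matrix.of fun i j => L (p i * q j)) =
      (Matrix.of fun i j : Fin n => (p j).coeff i).transpose *
        (Matrix.of fun i j : Fin n => L (X ^ (i : ℕ) * X ^ (j : ℕ))) *
        (Matrix.of fun i j : Fin n => (q j).coeff i) := by
    ext i j
    have hij : L (p i * q j) = L ((∑ s : Fin n, (p i).coeff s • X ^ (s : ℕ)) *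
        ∑ t : Fin n, (q j).coeff t • X ^ (t : ℕ)) := by
      rw [← expand _ i (hp i), ← expand _ j (hq j)]
    simp only [Matrix.mul_apply, Matrix.transpose_apply, Matrix.of_apply, Finset.sum_mul]
    rw [hij, Finset.sum_mul_sum, Finset.sum_comm]
    simp only [map_sum, smul_mul_smul_comm, map_smul, smul_eq_mul]
    refine Finset.sum_congr rfl fun t _ => Finset.sum_congr rfl fun s _ => ?_
    ring
  rw [key, Matrix.det_mul, Matrix.det_mul, Matrix.det_transpose,
    Matrix.det_matrixOfPolynomials p (fun i => (hp i).natDegree_eq) (fun i => (hp i).monic),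
    Matrix.det_matrixOfPolynomials q (fun i => (hq i).natDegree_eq) (fun i => (hq i).monic)]
  ring

theorem Fin.sign_revPerm (n : ℕ) :
    Equiv.Perm.sign (Fin.revPerm : Equiv.Perm (Fin n)) = (-1) ^ n.choose 2 := by
  induction n with
  | zero => simp [Subsingleton.elim (Fin.revPerm : Equiv.Perm (Fin 0)) 1]
  | succ n ih =>
    have h : finRotate (n + 1) * Fin.revPerm =
        Equiv.Perm.decomposeFin.symm (0, (Fin.revPerm : Equiv.Perm (Fin n))) := by
      ext i
      refine Fin.cases ?_ (fun j => ?_) i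
      · simp
      · have hj : (Fin.rev j.succ) ≠ Fin.last n := by
          simp [Fin.ext_iff, Fin.val_rev]; omega
        rw [Equiv.Perm.mul_apply, Fin.revPerm_apply,
          coe_finRotate_of_ne_last hj]
        simp [Fin.val_rev]
    have h2 := congrArg Equiv.Perm.sign h
    rw [Equiv.Perm.sign_mul, sign_finRotate, Equiv.Perm.decomposeFin.symm_sign, ih] at h2
    simp only [Nat.succ_eq_add_one, Nat.add_sub_cancel, if_pos, one_mul] at h2
    rw [Nat.choose_succ_succ' n 1, Nat.choose_one_right, pow_add, ← h2, ← mul_assoc, ← mul_pow]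
    simp

namespace Polynomial.Chebyshev

variable (R : Type*) [CommRing R]

theorem S_mul_C (m k : ℤ) : S R m * C R k = S R (m + k) + S R (m - k) := by
  induction k using Polynomial.Chebyshev.induct with
  | zero => simp [mul_two]
  | one => rw [S_add_one, C_one]; ring
  | add_two k ih1 ih2 =>
    have h₁ := S_add_two R (m + k)
    have h₂ := S_sub_two R (m - k)
    have h₃ := C_add_two R k
    linear_combination (norm := ring_nf) S R m * h₃ - h₂ - h₁ - ih2 + (X : R[X]) * ih1
  | neg_add_one k ih1 ih2 =>
    have h₁ := S_add_two R (m + (-k - 1))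
    have h₂ := S_sub_two R (m - (-k - 1))
    have h₃ := C_add_two R (-k - 1)
    linear_combination (norm := ring_nf) S R m * h₃ - h₂ - h₁ - ih2 + (X : R[X]) * ih1

theorem isMonicOfDegree_C_succ [Nontrivial R] (n : ℕ) : IsMonicOfDegree (C R (n + 1)) (n + 1) := by
  induction n using Nat.twoStepInduction with
  | zero => simpa using isMonicOfDegree_X R
  | one =>
    have h : C R ((1 : ℕ) + 1) = X ^ 2 - 2 := by norm_num [C_two]
    rw [h]
    exact (isMonicOfDegree_X_pow R 2).sub (by simp)
  | more n h₁ h₂ =>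
    have h : C R ((n + 2 : ℕ) + 1) = X * C R ((n + 1 : ℕ) + 1) - C R (n + 1) := by
      have := C_add_two R (n + 1)
      push_cast
      convert this using 2; ring_nf
    rw [h]
    refine IsMonicOfDegree.sub ?_ (by rw [h₁.natDegree_eq]; omega)
    have := (isMonicOfDegree_X R).mul h₂
    rwa [add_comm 1] at this

theorem isMonicOfDegree_S_comp {q : R[X]} {d : ℕ} (hd : 0 < d) (hq : IsMonicOfDegree q d)
    (n : ℕ) : IsMonicOfDegree ((S R n).comp q) (n * d) := by
  induction n using Nat.twoStepInduction with
  | zero => simp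
  | one => simpa using hq
  | more n h₁ h₂ =>
    have h : (S R (n + 2 : ℕ)).comp q = q * (S R (n + 1 : ℕ)).comp q - (S R n).comp q := by
      push_cast
      simp
    rw [h]
    refine IsMonicOfDegree.sub ?_ (by rw [h₁.natDegree_eq]; nlinarith)
    have := hq.mul h₂
    rwa [show d + (n + 1) * d = (n + 2) * d by ring] at this

theorem isMonicOfDegree_S [Nontrivial R] (n : ℕ) : IsMonicOfDegree (S R n) n := by
  simpa using isMonicOfDegree_S_comp R one_pos (isMonicOfDegree_X R) n

end Polynomial.Chebyshev

section
open Polynomial LaurentPolynomial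

/-- The coefficient of `T (K - 1)` minus that of `T (K + 1)` in `p (T 1 + T (-1))`. On `X ^ m` it
counts the nonnegative `±1` paths of length `m` from height `0` to height `K - 1`. -/
noncomputable def ballotFunctional (K : ℤ) : ℤ[X] →ₗ[ℤ] ℤ where
  toFun p := ((T 1 - T (-1)) * aeval (T 1 + T (-1) : ℤ[T;T⁻¹]) p).coeff K
  map_add' p q := by simp [mul_add]
  map_smul' c p := by rw [map_smul, mul_smul_comm]; rfl

theorem ballotFunctional_apply (K : ℤ) (p : ℤ[X]) : ballotFunctional K p =
    ((T 1 - T (-1)) * aeval (T 1 + T (-1) : ℤ[T;T⁻¹]) p).coeff K := rfl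

theorem LaurentPolynomial.mul_aeval_S (c : ℤ) :
    (T 1 - T (-1)) * aeval (T 1 + T (-1) : ℤ[T;T⁻¹]) (Chebyshev.S ℤ c) =
      T (c + 1) - T (-(c + 1)) := by
  have h0 : (T 1 * T (-1) : ℤ[T;T⁻¹]) = 1 := by rw [← T_add]; simp
  induction c using Polynomial.Chebyshev.induct with
  | zero => simp
  | one =>
    simp only [Chebyshev.S_one, aeval_X]
    rw [show (1 + 1 : ℤ) = 1 + 1 from rfl, T_add, neg_add, T_add]
    ring
  | add_two n h₁ h₂ =>
    rw [Chebyshev.S_add_two, map_sub, map_mul, aeval_X, mul_sub, h₂, mul_left_comm, h₁]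
    rw [show (n + 2 + 1 : ℤ) = n + 1 + 1 + 1 by ring]
    simp only [neg_add, T_add _ (1 : ℤ), T_add _ (-1 : ℤ)]
    linear_combination (T n * T 1 - T (-n) * T (-1)) * h0
  | neg_add_one n h₁ h₂ =>
    rw [Chebyshev.S_sub_one, map_sub, map_mul, aeval_X, mul_sub, h₂, mul_left_comm, h₁]
    rw [show (-n - 1 + 1 : ℤ) = -n by ring]
    simp only [neg_add, neg_neg, T_add _ (1 : ℤ), T_add _ (-1 : ℤ)]
    linear_combination (T (-n) - T n) * h0

theorem ballotFunctional_S (K c : ℤ) : ballotFunctional K (Chebyshev.S ℤ c) =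
    (if c + 1 = K then 1 else 0) - (if -(c + 1) = K then 1 else 0) := by
  rw [ballotFunctional_apply, LaurentPolynomial.mul_aeval_S]
  simp

theorem ballotFunctional_comp_mul_S {K : ℤ} (hK : 0 < K) (a : ℕ) (c : ℤ) :
    ballotFunctional K ((Chebyshev.S ℤ a).comp (Chebyshev.C ℤ K) * Chebyshev.S ℤ c) =
      (if c + 1 = K * (a + 1) then 1 else 0) - (if -(c + 1) = K * (a + 1) then 1 else 0) := by
  induction a using Nat.twoStepInduction generalizing c with
  | zero => simpa using ballotFunctional_S K c
  | one =>
    simp only [Nat.cast_one, Chebyshev.S_one, X_comp]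
    rw [mul_comm, Chebyshev.S_mul_C, map_add, ballotFunctional_S, ballotFunctional_S]
    split_ifs <;> omega
  | more a h₁ h₂ =>
    have h : (Chebyshev.S ℤ (a + 2 : ℕ)).comp (Chebyshev.C ℤ K) * Chebyshev.S ℤ c =
        (Chebyshev.S ℤ (a + 1 : ℕ)).comp (Chebyshev.C ℤ K) * Chebyshev.S ℤ (c + K) +
        (Chebyshev.S ℤ (a + 1 : ℕ)).comp (Chebyshev.C ℤ K) * Chebyshev.S ℤ (c - K) -
        (Chebyshev.S ℤ a).comp (Chebyshev.C ℤ K) * Chebyshev.S ℤ c := by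
      push_cast
      rw [← mul_add, ← Chebyshev.S_mul_C, Chebyshev.S_add_two]
      simp only [sub_comp, mul_comp, X_comp]
      ring
    rw [h, map_sub, map_add, h₁, h₂, h₂]
    have ha : 0 ≤ K * a := by positivity
    push_cast
    simp only [mul_add, mul_one]
    generalize K * (a : ℤ) = y at ha
    split_ifs <;> omega

theorem ballotFunctional_X_pow_mul {K : ℤ} (hK : 0 < K) (a b : ℕ) (c : ℤ)
    (hc : b < K * (a + 1) + (c + 1)) (hc' : c + 1 + b ≤ K * (a + 1)) :
    ballotFunctional K (X ^ b * (Chebyshev.S ℤ a).comp (Chebyshev.C ℤ K) * Chebyshev.S ℤ c) =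
      if c + 1 + b = K * (a + 1) then 1 else 0 := by
  induction b generalizing c with
  | zero =>
    rw [pow_zero, one_mul, ballotFunctional_comp_mul_S hK]
    generalize K * (a + 1 : ℤ) = y at *
    split_ifs <;> omega
  | succ b ih =>
    have h : X ^ (b + 1) * (Chebyshev.S ℤ a).comp (Chebyshev.C ℤ K) * Chebyshev.S ℤ c =
        X ^ b * (Chebyshev.S ℤ a).comp (Chebyshev.C ℤ K) * Chebyshev.S ℤ (c + 1) +
        X ^ b * (Chebyshev.S ℤ a).comp (Chebyshev.C ℤ K) * Chebyshev.S ℤ (c - 1) := by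
      rw [← mul_add, Chebyshev.S_add_one]
      ring
    rw [h, map_add]
    push_cast at hc hc'
    rw [ih (c + 1) (by omega) (by omega), ih (c - 1) (by omega) (by omega)]
    push_cast
    generalize K * (a + 1 : ℤ) = y at *
    split_ifs <;> omega

theorem LaurentPolynomial.coeff_trinomial_pow (m d : ℕ) :
    ((T 1 + T (-1) + 1 : ℤ[T;T⁻¹]) ^ m).coeff d =
      ∑ l ∈ Finset.range (m + 1), (trinom m l (l + d) : ℤ) := by
  rw [show (T 1 + T (-1) + 1 : ℤ[T;T⁻¹]) = T (-1) + (T 1 + 1) by ring, add_pow]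
  simp only [add_pow, Finset.mul_sum, Finset.sum_mul, one_pow, mul_one, T_pow,
    AddMonoidAlgebra.coeff_sum, Finsupp.coe_finsetSum, Finset.sum_apply]
  refine Finset.sum_congr rfl fun l _ => ?_
  have h (j : ℕ) : (T (l * -1) * (T j * ((m - l).choose j : ℤ[T;T⁻¹])) *
      (m.choose l : ℤ[T;T⁻¹])).coeff d =
      if l + d = j then (m.choose l * (m - l).choose j : ℤ) else 0 := by
    have : T (l * -1) * (T j * ((m - l).choose j : ℤ[T;T⁻¹])) * (m.choose l : ℤ[T;T⁻¹]) =
        (m.choose l * (m - l).choose j : ℤ) • T ((j : ℤ) - l) := by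
      rw [sub_eq_add_neg, T_add, zsmul_eq_mul]
      push_cast
      simp only [mul_one, mul_neg]
      ring
    rw [this]
    simp only [AddMonoidAlgebra.coeff_smul, Finsupp.smul_apply, T_apply, smul_eq_mul, mul_ite,
      mul_one, mul_zero]
    congr 1
    simp only [eq_iff_iff]
    omega
  simp only [h, Finset.sum_ite_eq, Finset.mem_range, trinom]
  split_ifs with h'
  · push_cast; rfl
  · rw [Nat.choose_eq_zero_of_lt (by omega : m - l < l + d)]
    simp

theorem ballotFunctional_X_add_one_pow (k m : ℕ) :
    ballotFunctional (k + 1) ((X + 1) ^ m) =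
      ∑ l ∈ Finset.range (m + 1), ((trinom m l (l + k) : ℤ) - (trinom m l (l + k + 2) : ℤ)) := by
  rw [ballotFunctional_apply, map_pow, map_add (aeval _), aeval_X, map_one, Finset.sum_sub_distrib]
  simp only [add_assoc _ k 2]
  rw [← LaurentPolynomial.coeff_trinomial_pow, ← LaurentPolynomial.coeff_trinomial_pow, sub_mul]
  have h (f : ℤ[T;T⁻¹]) (s t : ℤ) : (T s * f).coeff (s + t) = f.coeff t := by
    rw [T, AddMonoidAlgebra.coeff_single_mul_apply, neg_add_cancel_left, one_mul]
  rw [AddMonoidAlgebra.coeff_sub, Finsupp.sub_apply, add_comm (k : ℤ) 1, h,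
    show (1 + k : ℤ) = -1 + (k + 2 : ℕ) by push_cast; ring, h]

theorem det_trinomial_hankel_eq (n k : ℕ) :
    Matrix.det (Matrix.of fun i j : Fin n =>
      ∑ l ∈ Finset.range (i.1 + j.1 + 1),
        ((trinom (i.1 + j.1) l (l + k) : ℤ) - (trinom (i.1 + j.1) l (l + k + 2) : ℤ))) =
    Matrix.det (Matrix.of fun i j : Fin n => ballotFunctional (k + 1)
      (X ^ (i.1 % (k + 1)) * (Chebyshev.S ℤ (i.1 / (k + 1) : ℕ)).comp (Chebyshev.C ℤ (k + 1)) *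
        Chebyshev.S ℤ j.1)) := by
  have h1 (i : Fin n) : IsMonicOfDegree ((X + 1 : ℤ[X]) ^ (i : ℕ)) i := by
    simpa using (isMonicOfDegree_X_add_one (1 : ℤ)).pow i
  rw [det_bilin_of_isMonicOfDegree _ _ (fun j : Fin n => Chebyshev.S ℤ j.1) (fun i => ?_)
      (fun i => Chebyshev.isMonicOfDegree_S ℤ i),
    ← det_bilin_of_isMonicOfDegree _ _ _ h1 h1]
  · simp only [← pow_add, ballotFunctional_X_add_one_pow]
  · have h := (isMonicOfDegree_X_pow ℤ (i.1 % (k + 1))).mul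
      (Chebyshev.isMonicOfDegree_S_comp ℤ k.succ_pos (Chebyshev.isMonicOfDegree_C_succ ℤ k)
        (i.1 / (k + 1)))
    rwa [Nat.succ_eq_add_one, mul_comm _ (k + 1), Nat.mod_add_div] at h

theorem ballotFunctional_row (k i j : ℕ)
    (hj : j + i % (k + 1) ≤ (k + 1) * (i / (k + 1)) + k) :
    ballotFunctional (k + 1)
      (X ^ (i % (k + 1)) * (Chebyshev.S ℤ (i / (k + 1) : ℕ)).comp (Chebyshev.C ℤ (k + 1)) *
        Chebyshev.S ℤ j) =
      if j + i % (k + 1) = (k + 1) * (i / (k + 1)) + k then 1 else 0 := by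
  have hb : i % (k + 1) < k + 1 := Nat.mod_lt _ k.succ_pos
  have e : ((k : ℤ) + 1) * ((i / (k + 1) : ℕ) + 1) =
      ((k + 1) * (i / (k + 1)) : ℕ) + (k + 1) := by push_cast; ring
  rw [ballotFunctional_X_pow_mul (by omega) _ _ _ (by rw [e]; omega) (by rw [e]; omega), e]
  congr 1
  simp only [eq_iff_iff]
  omega

end


/-- Corollary 14: `det_{0≤i,j≤n−1}( Σ_{ℓ≥0} (T(i+j;ℓ,ℓ+k) − T(i+j;ℓ,ℓ+k+2)) )`,
computed in `ℤ`, equals `(−1)^{n₁·C(k+1,2)}` if `n = n₁(k+1)` with `n₁ ≥ 1` and `0` if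
`k+1 ∤ n`.  The sum over `ℓ ≥ 0` is finite: all terms with `ℓ > i+j` vanish, so it is
written as a sum over `ℓ < i+j+1`. -/
theorem det_trinomial_hankel (n : ℕ) (hn : 0 < n) (k : ℕ) :
    (∀ n₁ : ℕ, 0 < n₁ → n = n₁ * (k + 1) →
      Matrix.det (Matrix.of fun i j : Fin n =>
          ∑ ℓ ∈ Finset.range (i.1 + j.1 + 1),
            ((trinom (i.1 + j.1) ℓ (ℓ + k) : ℤ) - (trinom (i.1 + j.1) ℓ (ℓ + k + 2) : ℤ))) =
        (-1 : ℤ) ^ (n₁ * Nat.choose (k + 1) 2)) ∧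
    (¬ (k + 1) ∣ n →
      Matrix.det (Matrix.of fun i j : Fin n =>
          ∑ ℓ ∈ Finset.range (i.1 + j.1 + 1),
            ((trinom (i.1 + j.1) ℓ (ℓ + k) : ℤ) - (trinom (i.1 + j.1) ℓ (ℓ + k + 2) : ℤ))) =
        0) := by
  rw [det_trinomial_hankel_eq]
  constructor
  · rintro n₁ - rfl
    let τ : Equiv.Perm (Fin n₁ × Fin (k + 1)) := Equiv.prodCongrRight fun _ => Fin.revPerm
    let σ : Equiv.Perm (Fin (n₁ * (k + 1))) := finProdFinEquiv.permCongr τ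
    have hσ (i) : (σ i).1 % (k + 1) = k - i.1 % (k + 1) ∧ (σ i).1 / (k + 1) = i.1 / (k + 1) := by
      have hlt : k - i.1 % (k + 1) < k + 1 := by omega
      have h : (σ i).1 = k - i.1 % (k + 1) + (k + 1) * (i.1 / (k + 1)) := by
        simp [σ, τ, Equiv.permCongr_apply, Fin.val_rev]
      rw [h, Nat.add_mul_mod_self_left, Nat.mod_eq_of_lt hlt,
        Nat.add_mul_div_left _ _ k.succ_pos, Nat.div_eq_of_lt hlt]
      simp
    have hsign : Equiv.Perm.sign σ = (-1) ^ (n₁ * (k + 1).choose 2) := by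
      rw [Equiv.Perm.sign_permCongr, Equiv.Perm.sign_prodCongrRight]
      simp [Fin.sign_revPerm, ← pow_mul, mul_comm]
    have hrow (i j : Fin (n₁ * (k + 1))) (hij : j ≤ i) := ballotFunctional_row k (σ i) j (by
      have := Nat.mod_add_div i.1 (k + 1)
      have : i.1 % (k + 1) < k + 1 := Nat.mod_lt _ k.succ_pos
      have : j.1 ≤ i.1 := hij
      rw [(hσ i).1, (hσ i).2]
      omega)
    set M := Matrix.of fun i j : Fin (n₁ * (k + 1)) => ballotFunctional (k + 1)
      (.X ^ (i.1 % (k + 1)) * (Polynomial.Chebyshev.S ℤ (i.1 / (k + 1) : ℕ)).comp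
        (Polynomial.Chebyshev.C ℤ (k + 1)) * Polynomial.Chebyshev.S ℤ j.1) with hM
    have hdet : (M.submatrix σ id).det = 1 := by
      rw [Matrix.det_of_isUpperTriangular]
      · refine Finset.prod_eq_one fun i _ => ?_
        have := Nat.mod_add_div i.1 (k + 1)
        have : i.1 % (k + 1) < k + 1 := Nat.mod_lt _ k.succ_pos
        rw [Matrix.submatrix_apply, id, hM, Matrix.of_apply, hrow i i le_rfl, if_pos]
        rw [(hσ i).1, (hσ i).2]
        omega
      · intro i j hij
        have hij : j < i := hij
        have := Nat.mod_add_div i.1 (k + 1)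
        have : i.1 % (k + 1) < k + 1 := Nat.mod_lt _ k.succ_pos
        have : j.1 < i.1 := hij
        rw [Matrix.submatrix_apply, id, hM, Matrix.of_apply, hrow i j hij.le, if_neg]
        rw [(hσ i).1, (hσ i).2]
        omega
    rw [Matrix.det_permute, hsign] at hdet
    push_cast at hdet
    calc M.det = (-1) ^ (n₁ * (k + 1).choose 2) * ((-1) ^ (n₁ * (k + 1).choose 2) * M.det) := by
          rw [← mul_assoc, ← mul_pow]; simp
      _ = _ := by rw [hdet, mul_one]
  · intro hk
    have hmod : n % (k + 1) ≠ 0 := fun h => hk (Nat.dvd_of_mod_eq_zero h)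
    have hdm := Nat.mod_add_div n (k + 1)
    have hlt : n % (k + 1) < k + 1 := Nat.mod_lt _ k.succ_pos
    refine Matrix.det_eq_zero_of_row_eq_zero ⟨(k + 1) * (n / (k + 1)), by omega⟩ fun j => ?_
    have h1 : (k + 1) * (n / (k + 1)) % (k + 1) = 0 := Nat.mul_mod_right _ _
    have h2 : (k + 1) * (n / (k + 1)) / (k + 1) = n / (k + 1) :=
      Nat.mul_div_cancel_left _ k.succ_pos
    have hj := j.2
    rw [Matrix.of_apply, ballotFunctional_row, if_neg]
    · rw [h1, h2]; omega
    · rw [h1, h2]; omega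
end

section
/- For all positive integers n and k, the n×n determinant det_{0≤i,j≤n−1}( C(2i+2j+2, i+j+k+1) ) equals (−1)^{C(n₁,2)·k + n₁·C(k,2)} if n = n₁k for a positive integer n₁, and equals 0 if k does not divide n. For k = 0, det_{0≤i,j≤n−1}( C(2i+2j+2, i+j+1) ) = 2^n. -/
open Finset Matrix

/-- The change-of-basis matrix `C(2i+1, i+1+a)`, which is lower unitriangular. -/
def oddBinomialMatrix (n : ℕ) : Matrix (Fin n) (Fin n) ℤ :=
  Matrix.of fun i a => ((2 * i.1 + 1).choose (i.1 + 1 + a.1) : ℤ)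

/-- The adjacency matrix of the graph on `{0, …, n-1}` in which `a` and `b` are joined when
`|a - b| = k` or `a + b + 1 = k`; when `k = 0` it is twice the identity. -/
def foldedShiftMatrix (n k : ℕ) : Matrix (Fin n) (Fin n) ℤ :=
  Matrix.of fun a b => (if b.1 = a.1 + k then 1 else 0) +
    ((if a.1 + b.1 + 1 = k then 1 else 0) + (if a.1 = b.1 + k then 1 else 0))

theorem det_oddBinomialMatrix (n : ℕ) : (oddBinomialMatrix n).det = 1 := by
  rw [Matrix.det_of_isLowerTriangular]
  · refine Finset.prod_eq_one fun i _ => ?_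
    simp only [oddBinomialMatrix, Matrix.of_apply]
    rw [show i.1 + 1 + i.1 = 2 * i.1 + 1 by ring]
    simp
  · intro i j hij
    have : i.1 < j.1 := by simpa using hij
    simp only [oddBinomialMatrix, Matrix.of_apply]
    rw [Nat.choose_eq_zero_of_lt (by omega)]
    rfl

/-- Vandermonde convolution for `C(2i+2j+2, i+j+k+1)`, folded about the centre of row `2i+1`. -/
theorem choose_eq_sum_folded (i j k : ℕ) :
    (2 * i + 2 * j + 2).choose (i + j + k + 1) =
      ∑ a ∈ range (i + 1), (2 * i + 1).choose (i + 1 + a) *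
        ((2 * j + 1).choose (j + 1 + (a + k)) +
          if a ≤ j + k then (2 * j + 1).choose (j + k - a) else 0) := by
  set K := i + j + k + 1 with hK
  let g : ℕ → ℕ := fun s =>
    (2 * i + 1).choose s * if s ≤ K then (2 * j + 1).choose (K - s) else 0
  have h1 : (2 * i + 2 * j + 2).choose K = ∑ s ∈ range (K + 1), g s := by
    rw [show 2 * i + 2 * j + 2 = (2 * i + 1) + (2 * j + 1) by ring, Nat.add_choose_eq,
      Finset.Nat.sum_antidiagonal_eq_sum_range_succ_mk]
    refine sum_congr rfl fun s hs => ?_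
    simp only [g]
    rw [if_pos (by simpa [Nat.lt_succ_iff] using hs)]
  have h2 : ∑ s ∈ range (K + 1), g s = ∑ s ∈ range ((i + 1) + (i + 1)), g s := by
    have e1 : ∑ s ∈ range (K + 1), g s = ∑ s ∈ range (K + 1 + ((i + 1) + (i + 1))), g s := by
      refine sum_subset (range_mono (by omega)) fun s _ hs => ?_
      simp only [mem_range] at hs
      simp only [g]
      rw [if_neg (by omega), mul_zero]
    have e2 : ∑ s ∈ range ((i + 1) + (i + 1)), g s =
        ∑ s ∈ range (K + 1 + ((i + 1) + (i + 1))), g s := by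
      refine sum_subset (range_mono (by omega)) fun s _ hs => ?_
      simp only [mem_range] at hs
      simp only [g]
      rw [Nat.choose_eq_zero_of_lt (by omega), zero_mul]
    rw [e1, e2]
  rw [h1, h2, sum_range_add, ← sum_range_reflect, ← sum_add_distrib]
  refine sum_congr rfl fun a ha => ?_
  have ha : a ≤ i := by simpa [Nat.lt_succ_iff] using ha
  simp only [g, mul_add]
  congr 1
  · rw [if_pos (by omega), show K - (i + 1 - 1 - a) = j + 1 + (a + k) by omega,
      Nat.choose_symm_of_eq_add (show 2 * i + 1 = (i + 1 - 1 - a) + (i + 1 + a) by omega)]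
  · simp only [show i + 1 + a ≤ K ↔ a ≤ j + k by omega,
      show K - (i + 1 + a) = j + k - a by omega]

theorem foldedShiftMatrix_mul_apply (n k : ℕ) (a j : Fin n) :
    (foldedShiftMatrix n k * (oddBinomialMatrix n)ᵀ) a j =
      (((2 * j.1 + 1).choose (j.1 + 1 + (a.1 + k)) +
          if a.1 ≤ j.1 + k then (2 * j.1 + 1).choose (j.1 + k - a.1) else 0 : ℕ) : ℤ) := by
  have hj := j.2
  have key : ∀ c (p : ℕ → Prop) [DecidablePred p], (∀ b, p b ↔ b = c) →
      ∑ b : Fin n, (if p b.1 then (1 : ℤ) else 0) * ((2 * j.1 + 1).choose (j.1 + 1 + b.1) : ℤ) =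
        ((2 * j.1 + 1).choose (j.1 + 1 + c) : ℤ) := by
    intro c p _ hp
    rw [Fin.sum_univ_eq_sum_range
      (fun b => (if p b then (1 : ℤ) else 0) * ((2 * j.1 + 1).choose (j.1 + 1 + b) : ℤ))]
    simp only [hp, ite_mul, one_mul, zero_mul, sum_ite_eq', mem_range]
    split_ifs with h
    · rfl
    · rw [Nat.choose_eq_zero_of_lt (by omega)]; rfl
  have zero : ∀ (p : ℕ → Prop) [DecidablePred p], (∀ b, ¬ p b) →
      ∑ b : Fin n, (if p b.1 then (1 : ℤ) else 0) * ((2 * j.1 + 1).choose (j.1 + 1 + b.1) : ℤ) =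
        0 := by
    intro p _ hp
    simp [hp]
  simp only [Matrix.mul_apply, foldedShiftMatrix, oddBinomialMatrix, Matrix.of_apply,
    Matrix.transpose_apply, add_mul, sum_add_distrib]
  rw [key (a.1 + k) (fun b => b = a.1 + k) (fun b => Iff.rfl)]
  push_cast
  congr 1
  rcases lt_or_ge a.1 k with h | h
  · rw [key (k - 1 - a.1) (fun b => a.1 + b + 1 = k) (fun b => by omega),
      zero (fun b => a.1 = b + k) (fun b => by omega), if_pos (by omega),
      show j.1 + 1 + (k - 1 - a.1) = j.1 + k - a.1 by omega, add_zero]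
  · rw [key (a.1 - k) (fun b => a.1 = b + k) (fun b => by omega),
      zero (fun b => a.1 + b + 1 = k) (fun b => by omega), zero_add]
    split_ifs with h'
    · rw [Nat.choose_symm_of_eq_add
        (show 2 * j.1 + 1 = (j.1 + 1 + (a.1 - k)) + (j.1 + k - a.1) by omega)]
    · rw [Nat.choose_eq_zero_of_lt (by omega)]; rfl

theorem hankel_eq_mul (n k : ℕ) :
    (Matrix.of fun i j : Fin n =>
      ((2 * i.1 + 2 * j.1 + 2).choose (i.1 + j.1 + k + 1) : ℤ)) =
      oddBinomialMatrix n * (foldedShiftMatrix n k * (oddBinomialMatrix n)ᵀ) := by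
  ext i j
  rw [Matrix.mul_apply]
  simp only [foldedShiftMatrix_mul_apply]
  simp only [Matrix.of_apply, oddBinomialMatrix]
  rw [choose_eq_sum_folded, Fin.sum_univ_eq_sum_range (fun a =>
    ((2 * i.1 + 1).choose (i.1 + 1 + a) : ℤ) * (((2 * j.1 + 1).choose (j.1 + 1 + (a + k)) +
      if a ≤ j.1 + k then (2 * j.1 + 1).choose (j.1 + k - a) else 0 : ℕ) : ℤ))]
  push_cast
  refine sum_subset (range_mono (by have := i.2; omega)) fun a _ ha => ?_
  simp only [mem_range] at ha
  rw [Nat.choose_eq_zero_of_lt (by omega)]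
  simp

theorem det_hankel_eq (n k : ℕ) :
    Matrix.det (Matrix.of fun i j : Fin n =>
      ((2 * i.1 + 2 * j.1 + 2).choose (i.1 + j.1 + k + 1) : ℤ)) =
      (foldedShiftMatrix n k).det := by
  simp [hankel_eq_mul, Matrix.det_mul, det_oddBinomialMatrix]

theorem det_fromBlocks_one_one_zero {m R : Type*} [Fintype m] [DecidableEq m] [CommRing R]
    (X : Matrix m m R) : (fromBlocks X 1 1 (0 : Matrix m m R)).det = (-1) ^ Fintype.card m := by
  have h : fromBlocks X 1 1 (0 : Matrix m m R) *
      fromBlocks 1 0 (1 - X) 1 = fromBlocks 1 1 1 0 := by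
    simp [fromBlocks_multiply]
  have := congrArg Matrix.det h
  simpa [Matrix.det_mul, Matrix.det_neg] using this

theorem det_foldedShiftMatrix_add (n k : ℕ) :
    (foldedShiftMatrix (n + (k + k)) k).det = (-1) ^ k * (foldedShiftMatrix n k).det := by
  let e : Fin n ⊕ (Fin k ⊕ Fin k) ≃ Fin (n + (k + k)) :=
    ((Equiv.refl _).sumCongr finSumFinEquiv).trans finSumFinEquiv
  let M := (foldedShiftMatrix (n + (k + k)) k).submatrix e e
  let X := M.toBlocks₂₂.toBlocks₁₁
  let B := M.toBlocks₁₂.toCols₁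
  let C := M.toBlocks₂₁.toRows₁
  have hM : M = fromBlocks (foldedShiftMatrix n k) (fromCols B 0) (fromRows C 0)
      (fromBlocks X 1 1 0) := by
    ext i j
    rcases i with i | i | i <;> rcases j with j | j | j <;>
      simp only [fromBlocks_apply₁₁, fromBlocks_apply₁₂, fromBlocks_apply₂₁, fromBlocks_apply₂₂,
        fromCols_apply_inl, fromCols_apply_inr, fromRows_apply_inl, fromRows_apply_inr] <;>
      first
      | rfl
      | have hi := i.2
        have hj := j.2
        simp only [M, e, foldedShiftMatrix, Matrix.one_apply, Fin.ext_iff, Matrix.submatrix_apply,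
          Matrix.of_apply, Matrix.zero_apply, Equiv.trans_apply, Equiv.sumCongr_apply,
          Sum.map_inl, Sum.map_inr, finSumFinEquiv_apply_left, finSumFinEquiv_apply_right,
          Equiv.refl_apply, Fin.val_castAdd, Fin.val_natAdd]
        split_ifs <;> first | rfl | omega
  have hP : fromBlocks X 1 1 0 * fromBlocks 0 1 1 (-X) = 1 := by
    simp [fromBlocks_multiply, fromBlocks_one]
  let := invertibleOfRightInverse _ _ hP
  have hinv : ⅟(fromBlocks X 1 1 0) = fromBlocks 0 1 1 (-X) := rfl
  rw [← det_submatrix_equiv_self e]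
  change M.det = _
  rw [hM, det_fromBlocks₂₂, det_fromBlocks_one_one_zero, Fintype.card_fin, hinv]
  simp [fromCols_mul_fromBlocks, fromCols_mul_fromRows]

theorem foldedShiftMatrix_self (k : ℕ) : foldedShiftMatrix k k =
    Matrix.of fun i j : Fin k => if i.1 + j.1 + 1 = k then 1 else 0 := by
  ext i j
  have hi := i.2
  have hj := j.2
  simp only [foldedShiftMatrix, Matrix.of_apply]
  rw [if_neg (by omega : ¬ j.1 = i.1 + k), if_neg (by omega : ¬ i.1 = j.1 + k), zero_add, add_zero]

theorem det_foldedShiftMatrix_self (k : ℕ) :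
    (foldedShiftMatrix k k).det = (-1) ^ k.choose 2 := by
  induction k with
  | zero => simp
  | succ k ih =>
    rw [foldedShiftMatrix_self] at ih ⊢
    rw [Matrix.det_succ_row_zero, Finset.sum_eq_single (Fin.last k)]
    · rw [Nat.choose_succ_succ, Nat.choose_one_right, pow_add, ← ih]
      simp only [Matrix.of_apply, Fin.val_last, Fin.val_zero, zero_add, if_true, mul_one]
      congr 2
      ext i j
      simp [Fin.succAbove_last]
      congr 1
      apply propext
      omega
    · intro j _ hj
      have : j.1 ≠ k := fun h => hj (Fin.ext h)
      simp [this]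
    · simp

theorem det_foldedShiftMatrix_mul (m k : ℕ) :
    (foldedShiftMatrix (m * k) k).det = (-1) ^ (m.choose 2 * k + m * k.choose 2) := by
  induction m using Nat.twoStepInduction with
  | zero => rw [Nat.zero_mul]; simp
  | one => rw [Nat.one_mul, det_foldedShiftMatrix_self]; simp
  | more m ih _ =>
    rw [show (m + 2) * k = m * k + (k + k) by ring, det_foldedShiftMatrix_add, ih, ← pow_add,
      show (m + 2).choose 2 = m.choose 2 + 2 * m + 1 by
        simp [Nat.choose_succ_succ]; ring,
      show (m.choose 2 + 2 * m + 1) * k + (m + 2) * k.choose 2 =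
        k + (m.choose 2 * k + m * k.choose 2) + 2 * (m * k + k.choose 2) by ring,
      pow_add _ _ (2 * _), pow_mul _ 2]
    simp

theorem det_foldedShiftMatrix_of_not_dvd {k : ℕ} (hk : 0 < k) (n : ℕ) (h : ¬ k ∣ n) :
    (foldedShiftMatrix n k).det = 0 := by
  induction n using Nat.strong_induction_on with
  | _ n ih =>
    have hn : 0 < n := Nat.pos_of_ne_zero fun h0 => h (h0 ▸ dvd_zero k)
    have hnk : n ≠ k := fun h0 => h (h0 ▸ dvd_rfl)
    rcases lt_or_gt_of_ne hnk with hlt | hgt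
    · refine Matrix.det_eq_zero_of_row_eq_zero ⟨0, hn⟩ fun j => ?_
      have := j.2
      simp only [foldedShiftMatrix, Matrix.of_apply]
      split_ifs <;> first | rfl | omega
    rcases lt_or_ge n (k + k) with hlt | hge
    · refine Matrix.det_zero_of_row_eq (i := ⟨k - 1, by omega⟩) (j := ⟨k, hgt⟩)
        (by simp only [ne_eq, Fin.mk.injEq]; omega) ?_
      ext j
      have := j.2
      simp only [foldedShiftMatrix, Matrix.of_apply]
      split_ifs <;> first | rfl | omega
    · obtain ⟨m, rfl⟩ := Nat.exists_eq_add_of_le' hge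
      rw [det_foldedShiftMatrix_add, ih m (by omega), mul_zero]
      exact fun hm => h (hm.add (Dvd.intro_left 2 (by ring)))

theorem foldedShiftMatrix_zero_right (n : ℕ) :
    foldedShiftMatrix n 0 = Matrix.diagonal fun _ => 2 := by
  ext i j
  simp only [foldedShiftMatrix, Matrix.of_apply, Matrix.diagonal_apply, Fin.ext_iff]
  split_ifs <;> first | rfl | omega | contradiction

/-- Corollary 20: `det_{0≤i,j≤n−1}( C(2i+2j+2, i+j+k+1) )` in `ℤ`. -/
theorem det_central_binomial_hankel_one (n : ℕ) (hn : 0 < n) :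
    (∀ k : ℕ, 0 < k →
      (∀ n₁ : ℕ, 0 < n₁ → n = n₁ * k →
        Matrix.det (Matrix.of fun i j : Fin n =>
            ((2 * i.1 + 2 * j.1 + 2).choose (i.1 + j.1 + k + 1) : ℤ)) =
          (-1 : ℤ) ^ (Nat.choose n₁ 2 * k + n₁ * Nat.choose k 2)) ∧
      (¬ k ∣ n →
        Matrix.det (Matrix.of fun i j : Fin n =>
            ((2 * i.1 + 2 * j.1 + 2).choose (i.1 + j.1 + k + 1) : ℤ)) = 0)) ∧
    Matrix.det (Matrix.of fun i j : Fin n =>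
        ((2 * i.1 + 2 * j.1 + 2).choose (i.1 + j.1 + 1) : ℤ)) = 2 ^ n := by
  refine ⟨fun k hk => ⟨fun n₁ _ hn₁ => ?_, fun h => ?_⟩, ?_⟩
  · rw [det_hankel_eq, hn₁, det_foldedShiftMatrix_mul]
  · rw [det_hankel_eq, det_foldedShiftMatrix_of_not_dvd hk n h]
  · have h := det_hankel_eq n 0
    rw [foldedShiftMatrix_zero_right, Matrix.det_diagonal] at h
    simpa using h
end
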